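/- arXiv:1405.6844 — 6 statements merged into one kernel-verified Lean document; each statement's English description precedes it below -/
import Mathlib

section
/- Let t, t⊥, t' > 0 and μ ∈ ℝ satisfy μ + t' > 2·t⊥ and μ − t' = −t⊥ (the quantum critical point between the semimetallic and insulating phases). Then for k ∈ [−π,π]³ one has λ(k) = 0 if and only if k = (0,0,0); moreover along the third axis the dispersion is quadratic rather than linear: for all k₃ ∈ [−π,π], λ(0,0,k₃) = t⊥·(1 − cos k₃) and (2·t⊥/π²)·k₃² ≤ λ(0,0,k₃) ≤ (t⊥/2)·k₃². -/
noncomputable section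

/-- `k₊ = (k₁ + k₂)/2`. -/
def kplus (k : Fin 3 → ℝ) : ℝ := (k 0 + k 1) / 2

/-- `k₋ = (k₁ − k₂)/2`. -/
def kminus (k : Fin 3 → ℝ) : ℝ := (k 0 - k 1) / 2

/-- `m₃(k) = μ − t' + t⊥·cos k₃ + t'·(cos k₊ · cos k₋ − 1)`. -/
def m3 (tperp t' μ : ℝ) (k : Fin 3 → ℝ) : ℝ :=
  μ - t' + tperp * Real.cos (k 2) + t' * (Real.cos (kplus k) * Real.cos (kminus k) - 1)

/-- `λ(k) = sqrt(t²(sin² k₊ + sin² k₋) + m₃(k)²)`. -/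
def lam (t tperp t' μ : ℝ) (k : Fin 3 → ℝ) : ℝ :=
  Real.sqrt (t ^ 2 * (Real.sin (kplus k) ^ 2 + Real.sin (kminus k) ^ 2)
    + m3 tperp t' μ k ^ 2)

/-- Pauli matrix `σ₁`. -/
def σ1 : Matrix (Fin 2) (Fin 2) ℂ := !![0, 1; 1, 0]

/-- Pauli matrix `σ₂`. -/
def σ2 : Matrix (Fin 2) (Fin 2) ℂ := !![0, -Complex.I; Complex.I, 0]

/-- Pauli matrix `σ₃`. -/
def σ3 : Matrix (Fin 2) (Fin 2) ℂ := !![1, 0; 0, -1]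


/-- At the quantum critical point `μ − t' = −t⊥` (with `μ + t' > 2 t⊥`): `λ` vanishes
on the cube `[−π,π]³` only at `k = 0`, and along the third axis the dispersion is
quadratic: `λ(0,0,k₃) = t⊥(1 − cos k₃)` with
`(2t⊥/π²) k₃² ≤ λ(0,0,k₃) ≤ (t⊥/2) k₃²` for `k₃ ∈ [−π,π]`. -/
theorem stmt9 (t tperp t' μ : ℝ) (ht : 0 < t) (htperp : 0 < tperp) (ht' : 0 < t')
    (h1 : μ + t' > 2 * tperp) (h2 : μ - t' = -tperp) :
    (∀ k : Fin 3 → ℝ, (∀ i, k i ∈ Set.Icc (-Real.pi) Real.pi) →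
      (lam t tperp t' μ k = 0 ↔ k = ![0, 0, 0])) ∧
    (∀ k3 : ℝ, k3 ∈ Set.Icc (-Real.pi) Real.pi →
      lam t tperp t' μ ![0, 0, k3] = tperp * (1 - Real.cos k3) ∧
      2 * tperp / Real.pi ^ 2 * k3 ^ 2 ≤ lam t tperp t' μ ![0, 0, k3] ∧
      lam t tperp t' μ ![0, 0, k3] ≤ tperp / 2 * k3 ^ 2) := by
  have hpi := Real.pi_pos
  have cz : ∀ x : ℝ, x ∈ Set.Icc (-Real.pi) Real.pi → Real.cos x = 1 → x = 0 := by
    intro x hx h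
    exact (Real.cos_eq_one_iff_of_lt_of_lt (by linarith [hx.1]) (by linarith [hx.2])).1 h
  have key : ∀ k3 : ℝ, lam t tperp t' μ ![0, 0, k3] = tperp * (1 - Real.cos k3) := by
    intro k3
    have e : t ^ 2 * (Real.sin (kplus ![0, 0, k3]) ^ 2 + Real.sin (kminus ![0, 0, k3]) ^ 2)
        + m3 tperp t' μ ![0, 0, k3] ^ 2 = (tperp * (1 - Real.cos k3)) ^ 2 := by
      simp [kplus, kminus, m3, h2]
      ring
    rw [lam, e]
    exact Real.sqrt_sq (mul_nonneg htperp.le (by linarith [Real.cos_le_one k3]))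
  refine ⟨?_, ?_⟩
  · intro k hk
    constructor
    · intro h
      have hnn : 0 ≤ t ^ 2 * (Real.sin (kplus k) ^ 2 + Real.sin (kminus k) ^ 2) := by positivity
      have h0 := (Real.sqrt_eq_zero (by positivity)).1 h
      have hm : m3 tperp t' μ k = 0 := by
        have : m3 tperp t' μ k ^ 2 = 0 := by nlinarith [sq_nonneg (m3 tperp t' μ k)]
        exact pow_eq_zero_iff (two_ne_zero) |>.1 this
      have hc : Real.cos (kplus k) * Real.cos (kminus k)
          = (Real.cos (k 0) + Real.cos (k 1)) / 2 := by
        have a : k 0 = kplus k + kminus k := by unfold kplus kminus; ring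
        have b : k 1 = kplus k - kminus k := by unfold kplus kminus; ring
        rw [a, b, Real.cos_add, Real.cos_sub]
        ring
      unfold m3 at hm
      rw [hc, h2] at hm
      have c0 := Real.cos_le_one (k 0)
      have c1 := Real.cos_le_one (k 1)
      have c2 := Real.cos_le_one (k 2)
      have p0 := mul_nonneg ht'.le (sub_nonneg.2 c0)
      have p1 := mul_nonneg ht'.le (sub_nonneg.2 c1)
      have p2 := mul_nonneg htperp.le (sub_nonneg.2 c2)
      have z0 : t' * (1 - Real.cos (k 0)) = 0 := by linarith
      have z1 : t' * (1 - Real.cos (k 1)) = 0 := by linarith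
      have z2 : tperp * (1 - Real.cos (k 2)) = 0 := by linarith
      have y0 := (mul_eq_zero.1 z0).resolve_left ht'.ne'
      have y1 := (mul_eq_zero.1 z1).resolve_left ht'.ne'
      have y2 := (mul_eq_zero.1 z2).resolve_left htperp.ne'
      have x0 := cz _ (hk 0) (by linarith)
      have x1 := cz _ (hk 1) (by linarith)
      have x2 := cz _ (hk 2) (by linarith)
      ext i
      fin_cases i
      · simpa using x0
      · simpa using x1
      · simpa using x2
    · rintro rfl
      rw [key]
      simp
  · intro k3 hk
    rw [key]
    refine ⟨rfl, ?_, ?_⟩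
    · have h := Real.cos_le_one_sub_mul_cos_sq (x := k3) (abs_le.2 hk)
      have := mul_le_mul_of_nonneg_left h htperp.le
      have e : 2 * tperp / Real.pi ^ 2 * k3 ^ 2 = tperp * (2 / Real.pi ^ 2 * k3 ^ 2) := by ring
      rw [e]
      linarith
    · have := mul_le_mul_of_nonneg_left (Real.one_sub_sq_div_two_le_cos (x := k3)) htperp.le
      linarith
end
end

section
/- Let t, t⊥, t' > 0 and μ ∈ ℝ satisfy μ + t' > 2·t⊥, and write (μ − t')/t⊥ = −1 + r with |r| ≤ 1/2. Then there exists a constant C > 0 depending only on t, t⊥, t' (and not on r) such that for every ε with |r|·t⊥ ≤ ε ≤ 1, the Lebesgue measure of the set {k ∈ [−π,π]³ : λ(k) ≤ ε} is at most C·ε^(5/2). (This anisotropic volume bound, with exponent 5/2 rather than 3, reflects the quadratic dispersion in the k₃ direction in the first renormalization group regime.) -/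
noncomputable section

open MeasureTheory

theorem aux_box (a b c : ℝ) (S : Set (Fin 3 → ℝ))
    (hS : ∀ k ∈ S, |k 0| ≤ a ∧ |k 1| ≤ b ∧ |k 2| ≤ c) (ha : 0 ≤ a) (hb : 0 ≤ b) (hc : 0 ≤ c) :
    volume S ≤ ENNReal.ofReal (8 * a * b * c) := by
  have hsub : S ⊆ Set.Icc (![-a, -b, -c]) (![a, b, c]) := by
    intro k hk
    obtain ⟨h0, h1, h2⟩ := hS k hk
    rw [abs_le] at h0 h1 h2
    refine ⟨?_, ?_⟩ <;> intro i <;> fin_cases i <;> simp [h0.1, h0.2, h1.1, h1.2, h2.1, h2.2]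
  refine (measure_mono hsub).trans ?_
  rw [Real.volume_Icc_pi, Fin.prod_univ_three, ← ENNReal.ofReal_mul (by simp; linarith),
    ← ENNReal.ofReal_mul (by simp; positivity)]
  apply ENNReal.ofReal_le_ofReal
  simp
  nlinarith

set_option maxHeartbeats 1000000 in
theorem aux_trig (t tperp t' : ℝ) (ht : 0 < t) (htperp : 0 < tperp) (ht' : 0 < t')
    (μ r : ℝ) (hμ : μ + t' > 2 * tperp) (hr : (μ - t') / tperp = -1 + r) (hr2 : |r| ≤ 1 / 2)
    (ε : ℝ) (h1 : |r| * tperp ≤ ε) (h2 : ε ≤ 1) (h3 : ε < 3 / 4 * tperp)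
    (k : Fin 3 → ℝ) (hk : ∀ i, k i ∈ Set.Icc (-Real.pi) Real.pi)
    (hl : lam t tperp t' μ k ≤ ε) :
    |k 0| ≤ Real.pi / t * ε ∧ |k 1| ≤ Real.pi / t * ε ∧
      |k 2| ≤ √(Real.pi ^ 2 / (2 * tperp) * (2 + t' / t ^ 2)) * √ε := by
  have hpi := Real.pi_pos
  have hε : 0 ≤ ε := le_trans (by positivity) h1
  unfold lam at hl
  rw [Real.sqrt_le_left hε] at hl
  have hμ' : μ - t' = tperp * (-1 + r) := by
    rw [← hr]; field_simp
  have hrle := abs_le.1 hr2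
  have hra := le_abs_self r
  set p := kplus k with hp
  set q := kminus k with hq
  have e0 : k 0 = p + q := by simp only [hp, hq, kplus, kminus]; ring
  have e1 : k 1 = p - q := by simp only [hp, hq, kplus, kminus]; ring
  have b0 := hk 0
  have b1 := hk 1
  have b2 := hk 2
  rw [e0] at b0
  rw [e1] at b1
  have hm : |m3 tperp t' μ k| ≤ ε := by
    apply abs_le_of_sq_le_sq _ hε
    nlinarith [mul_nonneg (sq_nonneg t) (add_nonneg (sq_nonneg (Real.sin p)) (sq_nonneg (Real.sin q)))]
  have hm' := (abs_le.1 hm).1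
  have hmeq : m3 tperp t' μ k = tperp * (-1 + r) + tperp * Real.cos (k 2)
      + t' * (Real.cos p * Real.cos q - 1) := by
    simp only [m3, hμ', hp, hq]
  rw [hmeq] at hm'
  have hc2 := Real.cos_le_one (k 2)
  have hpos : 0 < Real.cos p * Real.cos q := by
    by_contra hcon
    push Not at hcon
    have := mul_le_mul_of_nonneg_left hc2 htperp.le
    have h5 := mul_nonneg ht'.le (neg_nonneg.2 hcon)
    nlinarith
  have hpq : 0 < Real.cos p ∧ 0 < Real.cos q := by
    rcases mul_pos_iff.1 hpos with h | ⟨hcp, hcq⟩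
    · exact h
    · exfalso
      have key : ∀ x : ℝ, Real.cos x < 0 → Real.pi / 2 < |x| := by
        intro x hx
        by_contra hcon
        push Not at hcon
        have := abs_le.1 hcon
        exact absurd (Real.cos_nonneg_of_mem_Icc ⟨by linarith, by linarith⟩) (not_le.2 hx)
      have kp := key p hcp
      have kq := key q hcq
      obtain ⟨b01, b02⟩ := b0
      obtain ⟨b11, b12⟩ := b1
      rcases abs_cases p with hh | hh <;> rcases abs_cases q with gg | gg <;> linarith
  have key2 : ∀ x : ℝ, |x| ≤ Real.pi → 0 < Real.cos x → |x| ≤ Real.pi / 2 := by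
    intro x hx hc
    by_contra hcon
    push Not at hcon
    rw [← Real.cos_abs] at hc
    have := Real.cos_nonpos_of_pi_div_two_le_of_le hcon.le (by linarith)
    linarith
  have pb : |p| ≤ Real.pi := abs_le.2 ⟨by linarith [b0.1, b1.1], by linarith [b0.2, b1.2]⟩
  have qb : |q| ≤ Real.pi := abs_le.2 ⟨by linarith [b0.1, b1.2], by linarith [b0.2, b1.1]⟩
  have sp := Real.mul_abs_le_abs_sin (key2 p pb hpq.1)
  have sq := Real.mul_abs_le_abs_sin (key2 q qb hpq.2)
  have hS : t ^ 2 * (Real.sin p ^ 2 + Real.sin q ^ 2) ≤ ε ^ 2 := by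
    nlinarith [sq_nonneg (m3 tperp t' μ k)]
  have hsp : t * |Real.sin p| ≤ ε := by
    apply (sq_le_sq₀ (by positivity) hε).1
    rw [mul_pow, sq_abs]
    nlinarith [mul_nonneg (sq_nonneg t) (sq_nonneg (Real.sin q))]
  have hsq : t * |Real.sin q| ≤ ε := by
    apply (sq_le_sq₀ (by positivity) hε).1
    rw [mul_pow, sq_abs]
    nlinarith [mul_nonneg (sq_nonneg t) (sq_nonneg (Real.sin p))]
  have fin1 : ∀ x : ℝ, 2 / Real.pi * |x| ≤ |Real.sin x| → t * |Real.sin x| ≤ ε →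
      |x| ≤ Real.pi / t * ε / 2 := by
    intro x hx hy
    have h6 : t * (2 / Real.pi * |x|) ≤ ε := (mul_le_mul_of_nonneg_left hx ht.le).trans hy
    have h7 : |x| = (Real.pi / t / 2) * (t * (2 / Real.pi * |x|)) := by field_simp
    rw [h7]
    calc _ ≤ (Real.pi / t / 2) * ε := mul_le_mul_of_nonneg_left h6 (by positivity)
      _ = _ := by ring
  have fp := fin1 p sp hsp
  have fq := fin1 q sq hsq
  refine ⟨?_, ?_, ?_⟩
  · rw [e0]; linarith [abs_add_le p q]
  · rw [e1]; linarith [abs_sub p q]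
  · rw [← Real.sqrt_mul (by positivity)]
    apply Real.abs_le_sqrt
    have hq3 := Real.cos_le_one_sub_mul_cos_sq (abs_le.2 b2)
    have g2 : Real.cos p * Real.cos q ≤ 1 :=
      mul_le_one₀ (Real.cos_le_one p) hpq.2.le (Real.cos_le_one q)
    have g3 : tperp * (1 - Real.cos (k 2)) ≤ (2 + t' / t ^ 2) * ε := by
      have g6 : 0 ≤ t' * (1 - Real.cos p * Real.cos q) := mul_nonneg ht'.le (by linarith)
      have g7 : 0 ≤ t' / t ^ 2 * ε := by positivity
      have g8 := mul_le_mul_of_nonneg_right hra htperp.le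
      linarith
    have g4 : tperp * (2 / Real.pi ^ 2 * k 2 ^ 2) ≤ (2 + t' / t ^ 2) * ε :=
      (mul_le_mul_of_nonneg_left (by linarith) htperp.le).trans g3
    have g5 : k 2 ^ 2 = Real.pi ^ 2 / (2 * tperp) * (tperp * (2 / Real.pi ^ 2 * k 2 ^ 2)) := by
      field_simp
    rw [g5, mul_assoc]
    exact mul_le_mul_of_nonneg_left g4 (by positivity)

/-- First-regime anisotropic volume bound: with `(μ − t')/t⊥ = −1 + r`, `|r| ≤ 1/2`,
for every `ε` with `|r| t⊥ ≤ ε ≤ 1`, the Lebesgue measure of the sublevel set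
`{k ∈ [−π,π]³ : λ(k) ≤ ε}` is at most `C ε^(5/2)`, with `C` depending only on
`t, t⊥, t'` (not on `r`). -/
theorem stmt10 (t tperp t' : ℝ) (ht : 0 < t) (htperp : 0 < tperp) (ht' : 0 < t') :
    ∃ C > 0, ∀ μ r : ℝ, μ + t' > 2 * tperp → (μ - t') / tperp = -1 + r → |r| ≤ 1 / 2 →
      ∀ ε : ℝ, |r| * tperp ≤ ε → ε ≤ 1 →
        volume {k : Fin 3 → ℝ |
            (∀ i, k i ∈ Set.Icc (-Real.pi) Real.pi) ∧ lam t tperp t' μ k ≤ ε} ≤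
          ENNReal.ofReal (C * ε ^ ((5 : ℝ) / 2)) := by
  set K := √(Real.pi ^ 2 / (2 * tperp) * (2 + t' / t ^ 2)) with hK
  have hpi := Real.pi_pos
  have hD : 0 < (3 / 4 * tperp) ^ ((5 : ℝ) / 2) := by positivity
  refine ⟨8 * (Real.pi / t) ^ 2 * K + 8 * Real.pi ^ 3 / (3 / 4 * tperp) ^ ((5 : ℝ) / 2),
    by positivity, ?_⟩
  intro μ r hμ hr hr2 ε h1 h2
  have hε : 0 ≤ ε := le_trans (by positivity) h1
  by_cases h3 : ε < 3 / 4 * tperp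
  · refine (aux_box (Real.pi / t * ε) (Real.pi / t * ε) (K * √ε) _ (fun k hk =>
      aux_trig t tperp t' ht htperp ht' μ r hμ hr hr2 ε h1 h2 h3 k hk.1 hk.2)
      (by positivity) (by positivity) (by positivity)).trans ?_
    apply ENNReal.ofReal_le_ofReal
    have e : ε ^ ((5 : ℝ) / 2) = ε ^ 2 * √ε := by
      rw [Real.sqrt_eq_rpow, ← Real.rpow_natCast, ← Real.rpow_add_of_nonneg hε] <;> norm_num
    have : 0 ≤ 8 * Real.pi ^ 3 / (3 / 4 * tperp) ^ ((5 : ℝ) / 2) * ε ^ ((5 : ℝ) / 2) := by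
      positivity
    rw [add_mul]
    refine le_trans (le_of_eq ?_) (le_add_of_nonneg_right this)
    rw [e]; ring
  · push Not at h3
    refine (aux_box Real.pi Real.pi Real.pi _ (fun k hk =>
      ⟨abs_le.2 (hk.1 0), abs_le.2 (hk.1 1), abs_le.2 (hk.1 2)⟩)
      hpi.le hpi.le hpi.le).trans ?_
    apply ENNReal.ofReal_le_ofReal
    have m : (3 / 4 * tperp) ^ ((5 : ℝ) / 2) ≤ ε ^ ((5 : ℝ) / 2) :=
      Real.rpow_le_rpow (by positivity) h3 (by norm_num)
    have h4 : 8 * Real.pi ^ 3 ≤ 8 * Real.pi ^ 3 / (3 / 4 * tperp) ^ ((5 : ℝ) / 2) * ε ^ ((5 : ℝ) / 2) := by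
      rw [div_mul_eq_mul_div, le_div_iff₀ hD]
      exact mul_le_mul_of_nonneg_left m (by positivity)
    have : 0 ≤ 8 * (Real.pi / t) ^ 2 * K * ε ^ ((5 : ℝ) / 2) := by positivity
    rw [add_mul]
    nlinarith
end
end

section
/- Let t, t⊥, t' > 0 and μ ∈ ℝ satisfy μ + t' > 2·t⊥, and write (μ − t')/t⊥ = −1 + r with 0 < r ≤ 1/2. Then there exists a constant C > 0 depending only on t, t⊥, t' (and not on r) such that for every ε with 0 < ε ≤ r·t⊥/10, the Lebesgue measure of the set {k ∈ [−π,π]³ : λ(k) ≤ ε} is at most C·ε³/√r. (This volume bound, with the factor 1/√r coming from the Fermi velocity v₃ ≍ t⊥·√r, reflects the linear relativistic dispersion near the two Weyl points in the second renormalization group regime.) -/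
noncomputable section

open MeasureTheory

lemma aux_sin (x δ : ℝ) (hx : x ∈ Set.Icc (-Real.pi) Real.pi) (h : |Real.sin x| ≤ δ) :
    x ∈ Set.Icc (-Real.pi - 2 * δ) (-Real.pi + 2 * δ) ∪ Set.Icc (0 - 2 * δ) (0 + 2 * δ)
      ∪ Set.Icc (Real.pi - 2 * δ) (Real.pi + 2 * δ) := by
  have key : ∀ y : ℝ, |y| ≤ Real.pi / 2 → |y| ≤ 2 * |Real.sin y| := by
    intro y hy
    have h1 := Real.mul_abs_le_abs_sin hy
    have h2 : (1:ℝ) / 2 ≤ 2 / Real.pi := by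
      rw [div_le_div_iff₀ (by norm_num) Real.pi_pos]
      linarith [Real.pi_le_four]
    nlinarith [abs_nonneg y]
  obtain ⟨h1, h2⟩ := hx
  by_cases ha : x < -(Real.pi / 2)
  · left; left
    have := key (x + Real.pi) (by rw [abs_le]; constructor <;> linarith)
    rw [Real.sin_add_pi, abs_neg] at this
    have := abs_le.mp (this.trans (mul_le_mul_of_nonneg_left h (by norm_num)))
    constructor <;> linarith
  · by_cases hb : x ≤ Real.pi / 2
    · left; right
      have := key x (by rw [abs_le]; constructor <;> linarith)
      have := abs_le.mp (this.trans (mul_le_mul_of_nonneg_left h (by norm_num)))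
      constructor <;> linarith
    · right
      have := key (x - Real.pi) (by rw [abs_le]; constructor <;> linarith)
      rw [Real.sin_sub_pi, abs_neg] at this
      have := abs_le.mp (this.trans (mul_le_mul_of_nonneg_left h (by norm_num)))
      constructor <;> linarith

lemma aux_cos (x r η : ℝ) (hx : x ∈ Set.Icc (-Real.pi) Real.pi) (hr : 0 < r) (hr2 : r ≤ 1 / 2)
    (h : |Real.cos x - (1 - r)| ≤ η) (hη : η ≤ r / 5) :
    x ∈ Set.Icc (Real.arccos (1 - r) - 4 * η / √r) (Real.arccos (1 - r) + 4 * η / √r) ∪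
      Set.Icc (-Real.arccos (1 - r) - 4 * η / √r) (-Real.arccos (1 - r) + 4 * η / √r) := by
  set a := Real.arccos (1 - r) with ha
  have hcos : Real.cos a = 1 - r := Real.cos_arccos (by linarith) (by linarith)
  have ha0 : 0 ≤ a := Real.arccos_nonneg _
  have ha1 : a ≤ Real.pi / 2 := Real.arccos_le_pi_div_two.mpr (by linarith)
  have hsr : 0 < √r := Real.sqrt_pos.mpr hr
  have hsin : √r / 2 ≤ Real.sin (a / 2) := by
    have h1 : 0 ≤ Real.sin (a / 2) := Real.sin_nonneg_of_nonneg_of_le_pi (by linarith) (by linarith)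
    have h2 : Real.cos a = 1 - 2 * Real.sin (a / 2) ^ 2 := by
      have := Real.cos_two_mul (a / 2)
      rw [show 2 * (a / 2) = a by ring] at this
      nlinarith [Real.sin_sq_add_cos_sq (a / 2)]
    have h3 : √r ^ 2 = r := Real.sq_sqrt hr.le
    nlinarith
  have main : ∀ y : ℝ, 0 ≤ y → y ≤ Real.pi → |Real.cos y - (1 - r)| ≤ η → |y - a| ≤ 4 * η / √r := by
    intro y hy0 hy1 hy
    have hy2 : y ≤ Real.pi / 2 := by
      by_contra hc
      have := Real.cos_nonpos_of_pi_div_two_le_of_le (by linarith : Real.pi / 2 ≤ y) (by linarith [Real.pi_pos])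
      have := (abs_le.mp hy).1
      linarith
    rw [← hcos, Real.cos_sub_cos, abs_mul, abs_mul] at hy
    have h1 : √r / 2 ≤ |Real.sin ((y + a) / 2)| :=
      (hsin.trans (Real.sin_le_sin_of_le_of_le_pi_div_two (by linarith [Real.pi_pos])
        (by linarith) (by linarith))).trans (le_abs_self _)
    have h2 : |y - a| / 4 ≤ |Real.sin ((y - a) / 2)| := by
      have h1 := Real.mul_abs_le_abs_sin (x := (y - a) / 2)
        (by rw [abs_le]; constructor <;> linarith)
      have h2 : (1:ℝ) / 2 ≤ 2 / Real.pi := by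
        rw [div_le_div_iff₀ (by norm_num) Real.pi_pos]
        linarith [Real.pi_le_four]
      have h3 : |(y - a) / 2| = |y - a| / 2 := by rw [abs_div]; norm_num
      rw [h3] at h1
      nlinarith [abs_nonneg (y - a)]
    have h3 : √r / 2 * (|y - a| / 4) ≤ |Real.sin ((y + a) / 2)| * |Real.sin ((y - a) / 2)| :=
      mul_le_mul h1 h2 (by positivity) (abs_nonneg _)
    rw [le_div_iff₀ hsr]
    norm_num at hy
    nlinarith
  rcases le_total 0 x with h0 | h0
  · left
    have := abs_le.mp (main x h0 hx.2 h)
    constructor <;> linarith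
  · right
    have := abs_le.mp (main (-x) (by linarith) (by linarith [hx.1]) (by rwa [Real.cos_neg]))
    constructor <;> linarith

lemma aux_vol (a w : ℝ) : volume (Set.Icc (a - w) (a + w)) = ENNReal.ofReal (2 * w) := by
  rw [Real.volume_Icc]; congr 1; ring

set_option maxHeartbeats 1000000 in
lemma aux_pt (t tperp t' μ r ε : ℝ) (ht : 0 < t) (htperp : 0 < tperp) (ht' : 0 < t')
    (hμ : μ + t' > 2 * tperp) (hr : (μ - t') / tperp = -1 + r) (hr0 : 0 < r) (hr1 : r ≤ 1 / 2)
    (hε : 0 < ε) (hεr : ε ≤ r * tperp / 10) (hc : ε * t' ≤ t ^ 2) (k : Fin 3 → ℝ)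
    (hk : lam t tperp t' μ k ≤ ε) :
    |Real.sin (k 0)| ≤ 2 * ε / t ∧ |Real.sin (k 1)| ≤ 2 * ε / t ∧
      |Real.cos (k 2) - (1 - r)| ≤ 2 * ε / tperp := by
  have e : μ - t' = tperp * (-1 + r) := by rw [← hr]; field_simp
  unfold lam at hk
  rw [Real.sqrt_le_left hε.le] at hk
  set p := kplus k with hp
  set q := kminus k with hq
  have h0 : k 0 = p + q := by rw [hp, hq, kplus, kminus]; ring
  have h1 : k 1 = p - q := by rw [hp, hq, kplus, kminus]; ring
  have hs : Real.sin p ^ 2 + Real.sin q ^ 2 ≤ (ε / t) ^ 2 := by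
    rw [div_pow, le_div_iff₀ (by positivity)]
    nlinarith [sq_nonneg (m3 tperp t' μ k)]
  have hsp : |Real.sin p| ≤ ε / t :=
    abs_le_of_sq_le_sq (by nlinarith [sq_nonneg (Real.sin q)]) (by positivity)
  have hsq : |Real.sin q| ≤ ε / t :=
    abs_le_of_sq_le_sq (by nlinarith [sq_nonneg (Real.sin p)]) (by positivity)
  have A : |Real.sin p * Real.cos q| ≤ ε / t := by
    rw [abs_mul]
    nlinarith [Real.abs_cos_le_one q, abs_nonneg (Real.sin p), abs_nonneg (Real.cos q)]
  have B : |Real.cos p * Real.sin q| ≤ ε / t := by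
    rw [abs_mul]
    nlinarith [Real.abs_cos_le_one p, abs_nonneg (Real.sin q), abs_nonneg (Real.cos p)]
  have E : 2 * ε / t = ε / t + ε / t := by ring
  refine ⟨?_, ?_, ?_⟩
  · rw [h0, Real.sin_add, E]
    exact (abs_add_le _ _).trans (add_le_add A B)
  · rw [h1, Real.sin_sub, E]
    exact (abs_sub _ _).trans (add_le_add A B)
  · have hm : |m3 tperp t' μ k| ≤ ε := abs_le_of_sq_le_sq (by
      have : 0 ≤ t ^ 2 * (Real.sin p ^ 2 + Real.sin q ^ 2) := by positivity
      linarith) hε.le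
    have ets : t' * (Real.sin p ^ 2 + Real.sin q ^ 2) ≤ ε := by
      have : t' * (ε / t) ^ 2 ≤ ε := by
        rw [div_pow, ← mul_div_assoc, div_le_iff₀ (by positivity)]
        nlinarith
      nlinarith
    set z := Real.cos p * Real.cos q with hz
    have hz2 : 1 - (Real.sin p ^ 2 + Real.sin q ^ 2) ≤ z ^ 2 := by
      have : z ^ 2 = (1 - Real.sin p ^ 2) * (1 - Real.sin q ^ 2) := by
        rw [hz, mul_pow, Real.cos_sq', Real.cos_sq']
      rw [this]
      nlinarith [mul_nonneg (sq_nonneg (Real.sin p)) (sq_nonneg (Real.sin q))]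
    have hz1 : |z| ≤ 1 := by
      rw [hz, abs_mul]
      exact mul_le_one₀ (Real.abs_cos_le_one p) (abs_nonneg _) (Real.abs_cos_le_one q)
    have hza : 1 - (Real.sin p ^ 2 + Real.sin q ^ 2) ≤ |z| := by
      rw [← sq_abs z] at hz2
      have h7 : |z| ^ 2 ≤ |z| := pow_le_of_le_one (abs_nonneg z) hz1 two_ne_zero
      linarith
    have hzt : t' - ε ≤ t' * |z| := by
      have := mul_le_mul_of_nonneg_left hza ht'.le
      linarith
    have hzt1 : t' * |z| ≤ t' := mul_le_of_le_one_right ht'.le hz1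
    have hmm := abs_le.mp hm
    have em : m3 tperp t' μ k = tperp * (Real.cos (k 2) - (1 - r)) + t' * (z - 1) := by
      unfold m3
      rw [e]; ring
    rw [em] at hmm
    have hrt : r * tperp ≤ tperp / 2 := by
      have := mul_le_mul_of_nonneg_right hr1 htperp.le
      linarith
    rcases le_total 0 z with hz0 | hz0
    · rw [abs_of_nonneg hz0] at hzt hzt1
      rw [abs_le]
      constructor
      · have : -(2 * ε) ≤ tperp * (Real.cos (k 2) - (1 - r)) := by linarith
        rw [← neg_div, div_le_iff₀ htperp]; linarith
      · rw [le_div_iff₀ htperp]; linarith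
    · exfalso
      rw [abs_of_nonpos hz0] at hzt
      have : tperp * Real.cos (k 2) ≤ tperp := mul_le_of_le_one_right htperp.le (Real.cos_le_one _)
      linarith

/-- Second-regime volume bound: with `(μ − t')/t⊥ = −1 + r`, `0 < r ≤ 1/2`, for every
`ε` with `0 < ε ≤ r t⊥/10`, the Lebesgue measure of the sublevel set
`{k ∈ [−π,π]³ : λ(k) ≤ ε}` is at most `C ε³/√r`, with `C` depending only on
`t, t⊥, t'` (not on `r`). -/
theorem stmt11 (t tperp t' : ℝ) (ht : 0 < t) (htperp : 0 < tperp) (ht' : 0 < t') :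
    ∃ C > 0, ∀ μ r : ℝ, μ + t' > 2 * tperp → (μ - t') / tperp = -1 + r →
      0 < r → r ≤ 1 / 2 →
      ∀ ε : ℝ, 0 < ε → ε ≤ r * tperp / 10 →
        volume {k : Fin 3 → ℝ |
            (∀ i, k i ∈ Set.Icc (-Real.pi) Real.pi) ∧ lam t tperp t' μ k ≤ ε} ≤
          ENNReal.ofReal (C * ε ^ 3 / Real.sqrt r) := by
  refine ⟨(24 / t) ^ 2 * (32 / tperp) + (2 * Real.pi) ^ 3 * (t' / t ^ 2) ^ 3, by positivity, ?_⟩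
  intro μ r hμ hr hr0 hr1 ε hε hεr
  have hsr : 0 < √r := Real.sqrt_pos.mpr hr0
  have hpi := Real.pi_pos
  by_cases hc : ε * t' ≤ t ^ 2
  · set A : Set ℝ := Set.Icc (-Real.pi - 2 * (2 * ε / t)) (-Real.pi + 2 * (2 * ε / t)) ∪
      Set.Icc (0 - 2 * (2 * ε / t)) (0 + 2 * (2 * ε / t))
      ∪ Set.Icc (Real.pi - 2 * (2 * ε / t)) (Real.pi + 2 * (2 * ε / t)) with hA
    set B : Set ℝ := Set.Icc (Real.arccos (1 - r) - 4 * (2 * ε / tperp) / √r)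
        (Real.arccos (1 - r) + 4 * (2 * ε / tperp) / √r) ∪
      Set.Icc (-Real.arccos (1 - r) - 4 * (2 * ε / tperp) / √r)
        (-Real.arccos (1 - r) + 4 * (2 * ε / tperp) / √r) with hB
    have vA : volume A ≤ ENNReal.ofReal (24 * ε / t) := by
      refine (measure_union_le _ _).trans ((add_le_add_left (measure_union_le _ _) _).trans ?_)
      rw [aux_vol, aux_vol, aux_vol, ← ENNReal.ofReal_add (by positivity) (by positivity),
        ← ENNReal.ofReal_add (by positivity) (by positivity)]
      apply ENNReal.ofReal_le_ofReal
      apply le_of_eq; ring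
    have vB : volume B ≤ ENNReal.ofReal (32 * ε / tperp / √r) := by
      refine (measure_union_le _ _).trans ?_
      rw [aux_vol, aux_vol, ← ENNReal.ofReal_add (by positivity) (by positivity)]
      apply ENNReal.ofReal_le_ofReal
      apply le_of_eq; ring
    have sub : {k : Fin 3 → ℝ |
            (∀ i, k i ∈ Set.Icc (-Real.pi) Real.pi) ∧ lam t tperp t' μ k ≤ ε} ⊆
        Set.univ.pi ![A, A, B] := by
      rintro k ⟨hk, hl⟩
      obtain ⟨h0, h1, h2⟩ := aux_pt t tperp t' μ r ε ht htperp ht' hμ hr hr0 hr1 hε hεr hc k hl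
      have h5 : 2 * ε / tperp ≤ r / 5 := by
        rw [div_le_iff₀ htperp]; linarith
      intro i _
      fin_cases i
      · exact aux_sin _ _ (hk 0) h0
      · exact aux_sin _ _ (hk 1) h1
      · exact aux_cos _ _ _ (hk 2) hr0 hr1 h2 h5
    refine (measure_mono sub).trans ?_
    rw [volume_pi_pi, Fin.prod_univ_three]
    change volume A * volume A * volume B ≤ _
    refine (mul_le_mul' (mul_le_mul' vA vA) vB).trans ?_
    rw [← ENNReal.ofReal_mul (by positivity), ← ENNReal.ofReal_mul (by positivity)]
    apply ENNReal.ofReal_le_ofReal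
    have : 0 ≤ (2 * Real.pi) ^ 3 * (t' / t ^ 2) ^ 3 * ε ^ 3 / √r := by positivity
    calc _ = (24 / t) ^ 2 * (32 / tperp) * ε ^ 3 / √r := by ring
      _ ≤ (24 / t) ^ 2 * (32 / tperp) * ε ^ 3 / √r
          + (2 * Real.pi) ^ 3 * (t' / t ^ 2) ^ 3 * ε ^ 3 / √r := by linarith
      _ = _ := by ring
  · push Not at hc
    have sub : {k : Fin 3 → ℝ |
            (∀ i, k i ∈ Set.Icc (-Real.pi) Real.pi) ∧ lam t tperp t' μ k ≤ ε} ⊆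
        Set.univ.pi (fun _ => Set.Icc (-Real.pi) Real.pi) := by
      rintro k ⟨hk, hl⟩ i _
      exact hk i
    refine (measure_mono sub).trans ?_
    rw [volume_pi_pi, Fin.prod_univ_three, Real.volume_Icc,
      ← ENNReal.ofReal_mul (by linarith), ← ENNReal.ofReal_mul (by nlinarith)]
    apply ENNReal.ofReal_le_ofReal
    rw [le_div_iff₀ hsr]
    have hs1 : √r ≤ 1 := Real.sqrt_le_one.mpr (by linarith)
    have h1 : 1 ≤ (t' / t ^ 2 * ε) ^ 3 := by
      apply one_le_pow₀
      rw [div_mul_eq_mul_div, one_le_div (by positivity)]; linarith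
    have h2 : 0 ≤ (24 / t) ^ 2 * (32 / tperp) * ε ^ 3 := by positivity
    have h3 : 0 < (2 * Real.pi) ^ 3 := by positivity
    calc _ = (2 * Real.pi) ^ 3 * √r := by ring
      _ ≤ (2 * Real.pi) ^ 3 * (t' / t ^ 2 * ε) ^ 3 := by
        apply mul_le_mul_of_nonneg_left (hs1.trans h1) h3.le
      _ ≤ (24 / t) ^ 2 * (32 / tperp) * ε ^ 3 + (2 * Real.pi) ^ 3 * (t' / t ^ 2 * ε) ^ 3 := by
        linarith
      _ = _ := by ring
end
end

section
/- Let β > 0, λ ∈ ℝ, and τ ∈ (0,β). For n ∈ ℤ let ω_n = (2n+1)·π/β be the fermionic Matsubara frequencies. Then the symmetric partial sums converge and lim_{N→∞} (1/β)·Σ_{n=−N}^{N−1} e^{−i·ω_n·τ}/(−i·ω_n + λ) = e^{−λ·τ}/(1 + e^{−β·λ}). -/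
open Filter

lemma rl_aux (β s : ℝ) (hβ : 0 < β) (hs : s ≠ 0) (h : ℝ → ℂ) :
    Tendsto (fun N : ℕ => ∫ t in (0:ℝ)..β, Complex.exp (Complex.I * (s * N * t : ℝ)) * h t)
      atTop (nhds 0) := by
  have h1 := Real.tendsto_integral_exp_smul_cocompact (Set.indicator (Set.Ioc 0 β) h)
  have h2 : Tendsto (fun N : ℕ => -(s / (2 * Real.pi)) * (N : ℝ)) atTop (cocompact ℝ) := by
    have hc : -(s / (2 * Real.pi)) ≠ 0 := by
      have := Real.pi_pos
      simp [hs, this.ne']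
    have h3 : Tendsto (fun x : ℝ => -(s / (2 * Real.pi)) * x) (cocompact ℝ) (cocompact ℝ) :=
      (Homeomorph.mulLeft₀ _ hc).isClosedEmbedding.tendsto_cocompact
    exact h3.comp (tendsto_natCast_atTop_atTop.mono_right atTop_le_cocompact)
  refine (h1.comp h2).congr fun N => ?_
  rw [intervalIntegral.integral_of_le hβ.le, ← MeasureTheory.integral_indicator measurableSet_Ioc]
  refine MeasureTheory.integral_congr_ae (Eventually.of_forall fun t => ?_)
  by_cases ht : t ∈ Set.Ioc 0 β
  · simp only [Set.indicator_of_mem ht, Circle.smul_def, Real.fourierChar_apply, smul_eq_mul]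
    congr 2
    have : (Real.pi : ℂ) ≠ 0 := by exact_mod_cast Real.pi_ne_zero
    push_cast
    field_simp
  · simp [Set.indicator_of_notMem ht]

lemma sum_aux (f : ℤ → ℂ) (N : ℕ) :
    ∑ n ∈ Finset.Icc (-((N + 1 : ℕ) : ℤ)) (((N + 1 : ℕ) : ℤ) - 1), f n
      = ∑ n ∈ Finset.Icc (-(N : ℤ)) ((N : ℤ) - 1), f n + f N + f (-(N : ℤ) - 1) := by
  have : Finset.Icc (-((N + 1 : ℕ) : ℤ)) (((N + 1 : ℕ) : ℤ) - 1)
      = insert (-(N : ℤ) - 1) (insert (N : ℤ) (Finset.Icc (-(N : ℤ)) ((N : ℤ) - 1))) := by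
    ext x
    simp only [Finset.mem_Icc, Finset.mem_insert]
    push_cast
    omega
  rw [this, Finset.sum_insert (by simp; omega), Finset.sum_insert (by simp)]
  ring

lemma dirichlet_aux (z : ℂ) (N : ℕ) :
    (∑ n ∈ Finset.Icc (-(N : ℤ)) ((N : ℤ) - 1), Complex.exp ((2 * n + 1) * z)) *
      (Complex.exp z - Complex.exp (-z)) =
      Complex.exp (2 * N * z) - Complex.exp (-(2 * N * z)) := by
  induction N with
  | zero => simp
  | succ N ih =>
    rw [sum_aux, add_mul, add_mul, ih, mul_sub, mul_sub]
    simp only [← Complex.exp_add]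
    push_cast
    ring_nf

lemma quot_aux (β lam τ : ℝ) (hβ : 0 < β) (hτ0 : 0 < τ) (hτβ : τ < β) :
    ∃ h : ℝ → ℂ, ContinuousOn h (Set.Icc 0 β) ∧ ∀ t ∈ Set.Icc 0 β,
      Complex.exp (-lam * t) - Complex.exp (-lam * τ) *
        Complex.exp (Complex.I * (Real.pi / β) * (t - τ)) =
      (Complex.exp (Complex.I * (Real.pi / β) * (t - τ)) -
        Complex.exp (-(Complex.I * (Real.pi / β) * (t - τ)))) * h t := by
  set F : ℝ → ℂ := fun t => Complex.exp (-lam * t) - Complex.exp (-lam * τ) *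
        Complex.exp (Complex.I * (Real.pi / β) * (t - τ)) with hF
  set S : ℝ → ℂ := fun t => Complex.exp (Complex.I * (Real.pi / β) * (t - τ)) -
        Complex.exp (-(Complex.I * (Real.pi / β) * (t - τ))) with hS
  have hd (t : ℝ) : HasDerivAt (fun t : ℝ => Complex.I * (Real.pi / β) * ((t:ℂ) - τ))
      (Complex.I * (Real.pi / β)) t := by
    simpa using ((Complex.ofRealCLM.hasDerivAt (x := t)).sub_const (τ : ℂ)).const_mul
      (Complex.I * (Real.pi / β))
  have hdl (t : ℝ) : HasDerivAt (fun t : ℝ => -(lam : ℂ) * (t:ℂ)) (-lam) t := by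
    simpa using (Complex.ofRealCLM.hasDerivAt (x := t)).const_mul (-(lam : ℂ))
  have hFd : Differentiable ℝ F := fun t =>
    ((hdl t).cexp.sub ((hd t).cexp.const_mul _)).differentiableAt
  have hSd' (t : ℝ) := (hd t).cexp.sub (hd t).neg.cexp
  have hSd : Differentiable ℝ S := fun t => (hSd' t).differentiableAt
  have hFτ : F τ = 0 := by simp [hF]
  have hSτ : S τ = 0 := by simp [hS]
  have hpi : (Real.pi : ℂ) ≠ 0 := by exact_mod_cast Real.pi_ne_zero
  have hβc : (β : ℂ) ≠ 0 := by exact_mod_cast hβ.ne'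
  have hS' : deriv S τ ≠ 0 := by
    have := (hSd' τ).deriv
    have h2 : deriv S τ = 2 * (Complex.I * (Real.pi / β)) := by
      refine this.trans ?_
      simp
      ring
    rw [h2]
    simp [hpi, hβc]
  have hSne : ∀ t ∈ Set.Icc 0 β, t ≠ τ → S t ≠ 0 := by
    intro t ht hne h0
    have e : S t = 2 * Complex.I * ((Real.sin (Real.pi / β * (t - τ)) : ℝ) : ℂ) := by
      simp only [hS]
      push_cast
      rw [Complex.sin]
      ring_nf
      simp
      ring_nf
    rw [e] at h0
    have h1 : Real.sin (Real.pi / β * (t - τ)) = 0 := by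
      have : (2 * Complex.I) ≠ 0 := by simp
      exact_mod_cast (mul_eq_zero.mp h0).resolve_left this
    have hx : Real.pi / β * (t - τ) = Real.pi * ((t - τ) / β) := by ring
    have ha : (t - τ) / β < 1 := by rw [div_lt_one hβ]; linarith [ht.2]
    have hb : -1 < (t - τ) / β := by rw [lt_div_iff₀ hβ]; linarith [ht.1]
    rw [Real.sin_eq_zero_iff_of_lt_of_lt (by rw [hx]; nlinarith [Real.pi_pos])
      (by rw [hx]; nlinarith [Real.pi_pos])] at h1
    have := Real.pi_pos
    have h3 : Real.pi / β ≠ 0 := by positivity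
    exact hne (by linarith [(mul_eq_zero.mp h1).resolve_left h3])
  have hds : ∀ t ∈ Set.Icc 0 β, dslope S τ t ≠ 0 := by
    intro t ht
    by_cases hne : t = τ
    · subst hne; rwa [dslope_same]
    · intro h0
      have := sub_smul_dslope S τ t
      rw [h0, hSτ] at this
      simp at this
      exact hSne t ht hne this.symm
  have hc (G : ℝ → ℂ) (hG : Differentiable ℝ G) : ContinuousOn (dslope G τ) (Set.Icc 0 β) :=
    (continuousOn_dslope (Icc_mem_nhds hτ0 hτβ)).2 ⟨hG.continuous.continuousOn, hG τ⟩
  refine ⟨fun t => dslope F τ t / dslope S τ t, (hc F hFd).div (hc S hSd) hds, fun t ht => ?_⟩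
  change F t = S t * _
  have e1 := sub_smul_dslope F τ t
  have e2 := sub_smul_dslope S τ t
  rw [hFτ, sub_zero] at e1
  rw [hSτ, sub_zero] at e2
  rw [← e1, ← e2]
  have := hds t ht
  simp only [Complex.real_smul]
  field_simp

lemma orth_aux (β τ : ℝ) (hβ : 0 < β) (N : ℕ) (hN : 1 ≤ N) :
    ∫ t in (0:ℝ)..β, (∑ n ∈ Finset.Icc (-(N : ℤ)) ((N : ℤ) - 1),
      Complex.exp ((2 * n + 1) * (Complex.I * (Real.pi / β) * (t - τ)))) *
        Complex.exp (Complex.I * (Real.pi / β) * (t - τ)) = β := by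
  have hpi : (Real.pi : ℂ) ≠ 0 := by exact_mod_cast Real.pi_ne_zero
  have hβc : (β : ℂ) ≠ 0 := by exact_mod_cast hβ.ne'
  simp_rw [Finset.sum_mul]
  rw [intervalIntegral.integral_finsetSum
    (fun n _ => Continuous.intervalIntegrable (by fun_prop) _ _)]
  rw [Finset.sum_eq_single (-1)]
  · rw [intervalIntegral.integral_congr (g := fun _ => (1:ℂ))]
    · simp
    · intro t _
      simp only [← Complex.exp_add]
      rw [Complex.exp_eq_one_iff]
      refine ⟨0, ?_⟩
      push_cast
      ring
  · intro n _ hn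
    have hn' : ((n : ℂ) + 1) ≠ 0 := by
      intro h
      apply hn
      have : n + 1 = 0 := by exact_mod_cast h
      omega
    have hc : 2 * ((n : ℂ) + 1) * (Complex.I * (Real.pi / β)) ≠ 0 := by
      simp [hn', hpi, hβc]
    rw [intervalIntegral.integral_congr (g := fun t : ℝ =>
      Complex.exp (2 * ((n : ℂ) + 1) * (Complex.I * (Real.pi / β)) * (-τ)) *
      Complex.exp (2 * ((n : ℂ) + 1) * (Complex.I * (Real.pi / β)) * t))]
    · rw [intervalIntegral.integral_const_mul, integral_exp_mul_complex hc]
      have : Complex.exp (2 * ((n : ℂ) + 1) * (Complex.I * (Real.pi / β)) * β) = 1 := by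
        rw [Complex.exp_eq_one_iff]
        refine ⟨n + 1, ?_⟩
        push_cast
        field_simp
      rw [this]
      simp
    · intro t _
      simp only [← Complex.exp_add]
      congr 1
      ring
  · intro h
    exfalso
    apply h
    simp
    omega

lemma term_aux (β lam τ : ℝ) (hβ : 0 < β) (n : ℤ) :
    Complex.exp (-Complex.I * (((2 * n + 1) * Real.pi / β : ℝ) : ℂ) * (τ : ℂ)) /
      (-Complex.I * (((2 * n + 1) * Real.pi / β : ℝ) : ℂ) + (lam : ℂ)) =
    (1 + Complex.exp (-β * lam))⁻¹ * ∫ t in (0:ℝ)..β,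
      Complex.exp ((2 * n + 1) * (Complex.I * (Real.pi / β) * (t - τ))) *
        Complex.exp (-lam * t) := by
  have hpi : (Real.pi : ℂ) ≠ 0 := by exact_mod_cast Real.pi_ne_zero
  have hβc : (β : ℂ) ≠ 0 := by exact_mod_cast hβ.ne'
  set w : ℝ := (2 * n + 1) * Real.pi / β with hw
  have hw0 : w ≠ 0 := by
    have : (2 * (n:ℝ) + 1) ≠ 0 := by
      intro h
      have : 2 * n + 1 = 0 := by exact_mod_cast h
      omega
    have := Real.pi_ne_zero
    have := hβ.ne'
    positivity
  have hc : Complex.I * w - lam ≠ 0 := by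
    intro h
    have := congrArg Complex.im h
    simp at this
    exact hw0 this
  have hc' : -Complex.I * w + lam ≠ 0 := by
    intro h
    apply hc
    linear_combination -h
  have h1 : 1 + Complex.exp (-β * lam) ≠ 0 := by
    have : (0:ℝ) < 1 + Real.exp (-β * lam) := by positivity
    exact_mod_cast this.ne'
  rw [intervalIntegral.integral_congr (g := fun t : ℝ =>
      Complex.exp (-Complex.I * w * τ) * Complex.exp ((Complex.I * w - lam) * t))]
  · rw [intervalIntegral.integral_const_mul, integral_exp_mul_complex hc]
    have : Complex.exp ((Complex.I * w - lam) * β) = - Complex.exp (-β * lam) := by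
      have e : (Complex.I * w - lam) * β
          = -β * lam + (Real.pi * Complex.I + n * (2 * Real.pi * Complex.I)) := by
        rw [hw]
        push_cast
        field_simp
        ring
      rw [e, Complex.exp_add, Complex.exp_add, Complex.exp_int_mul_two_pi_mul_I,
        Complex.exp_pi_mul_I]
      ring
    rw [this]
    simp only [Complex.ofReal_zero, mul_zero, Complex.exp_zero]
    rw [inv_mul_eq_div, div_eq_div_iff hc' h1, mul_assoc (Complex.exp _) (_ / _)]
    congr 1
    rw [div_mul_eq_mul_div, eq_div_iff hc]
    ring
  · intro t _
    simp only [← Complex.exp_add]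
    congr 1
    rw [hw]
    push_cast
    ring

/-- Matsubara sum identity: for `β > 0`, `λ ∈ ℝ`, `τ ∈ (0,β)`, with fermionic
Matsubara frequencies `ω_n = (2n+1)π/β`, the symmetric partial sums converge and
`lim_{N→∞} (1/β) Σ_{n=−N}^{N−1} e^{−iω_nτ}/(−iω_n + λ) = e^{−λτ}/(1 + e^{−βλ})`. -/
theorem stmt13 (β lam τ : ℝ) (hβ : 0 < β) (hτ0 : 0 < τ) (hτβ : τ < β) :
    Tendsto
      (fun N : ℕ =>
        (1 / (β : ℂ)) *
          ∑ n ∈ Finset.Icc (-(N : ℤ)) ((N : ℤ) - 1),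
            Complex.exp (-Complex.I * (((2 * n + 1) * Real.pi / β : ℝ) : ℂ) * (τ : ℂ)) /
              (-Complex.I * (((2 * n + 1) * Real.pi / β : ℝ) : ℂ) + (lam : ℂ)))
      atTop
      (nhds ((Real.exp (-lam * τ) / (1 + Real.exp (-β * lam)) : ℝ) : ℂ)) := by
  have hβc : (β : ℂ) ≠ 0 := by exact_mod_cast hβ.ne'
  have hpi := Real.pi_pos
  obtain ⟨h, hcont, hh⟩ := quot_aux β lam τ hβ hτ0 hτβ
  set s : ℝ := 2 * Real.pi / β with hs
  have hs0 : s ≠ 0 := by positivity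
  set g₁ : ℝ → ℂ := h
  have hint : ∀ r : ℝ, IntervalIntegrable
      (fun t : ℝ => Complex.exp (Complex.I * (r * t : ℝ)) * h t) MeasureTheory.volume 0 β := by
    intro r
    apply ContinuousOn.intervalIntegrable
    rw [Set.uIcc_of_le hβ.le]
    exact (Continuous.continuousOn (by fun_prop)).mul hcont
  have hphase : ∀ r : ℝ, r ≠ 0 → Tendsto (fun N : ℕ => Complex.exp (-(Complex.I * (r * N * τ : ℝ))) *
      ∫ t in (0:ℝ)..β, Complex.exp (Complex.I * (r * N * t : ℝ)) * h t) atTop (nhds 0) := by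
    intro r hr
    have := rl_aux β r hβ hr h
    rw [tendsto_zero_iff_norm_tendsto_zero] at this ⊢
    refine this.congr fun N => ?_
    rw [norm_mul, show -(Complex.I * ((r * N * τ : ℝ) : ℂ)) = ((-(r * N * τ) : ℝ) : ℂ) * Complex.I by
      push_cast; ring, Complex.norm_exp_ofReal_mul_I, one_mul]
  have hlim := (hphase s hs0).sub (hphase (-s) (neg_ne_zero.mpr hs0))
  have hlim2 := ((hlim.add_const (Complex.exp (-lam * τ) * β)).const_mul
    (1 / (β : ℂ) * (1 + Complex.exp (-β * lam))⁻¹))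
  have hfin : 1 / (β : ℂ) * (1 + Complex.exp (-β * lam))⁻¹ *
      (0 - 0 + Complex.exp (-lam * τ) * β) =
      ((Real.exp (-lam * τ) / (1 + Real.exp (-β * lam)) : ℝ) : ℂ) := by
    push_cast
    field_simp
    ring
  rw [hfin] at hlim2
  refine hlim2.congr' ?_
  filter_upwards [eventually_ge_atTop 1] with N hN
  simp_rw [term_aux β lam τ hβ]
  rw [← Finset.mul_sum, ← intervalIntegral.integral_finsetSum
    (fun n _ => Continuous.intervalIntegrable (by fun_prop) _ _), mul_assoc]
  congr 2
  have hor := congrArg (fun z => Complex.exp (-lam * τ) * z) (orth_aux β τ hβ N hN)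
  beta_reduce at hor
  rw [← hor]
  rw [← intervalIntegral.integral_const_mul, ← intervalIntegral.integral_const_mul,
    ← intervalIntegral.integral_const_mul, ← intervalIntegral.integral_sub
      ((hint (s * N)).const_mul _) ((hint (-s * N)).const_mul _),
    ← intervalIntegral.integral_add
      (((hint (s * N)).const_mul _).sub ((hint (-s * N)).const_mul _))
      (Continuous.intervalIntegrable (by fun_prop) _ _)]
  refine intervalIntegral.integral_congr fun t ht => ?_
  rw [Set.uIcc_of_le hβ.le] at ht
  have e1 := hh t ht
  have e2 := dirichlet_aux (Complex.I * (Real.pi / β) * (t - τ)) N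
  beta_reduce
  rw [← Finset.sum_mul]
  have p1 : -(Complex.I * ((s * N * τ : ℝ) : ℂ)) + Complex.I * ((s * N * t : ℝ) : ℂ)
      = 2 * N * (Complex.I * (Real.pi / β) * (t - τ)) := by
    rw [hs]; push_cast; ring
  have p2 : -(Complex.I * ((-s * N * τ : ℝ) : ℂ)) + Complex.I * ((-s * N * t : ℝ) : ℂ)
      = -(2 * N * (Complex.I * (Real.pi / β) * (t - τ))) := by
    rw [hs]; push_cast; ring
  rw [← mul_assoc, ← mul_assoc (Complex.exp (-(Complex.I * ((-s * N * τ : ℝ) : ℂ)))),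
    ← Complex.exp_add, ← Complex.exp_add, p1, p2, ← sub_mul, ← e2, mul_assoc, ← e1]
  ring
end

section
/- Let λ > 0 and x₀ > 0. Then the symmetric improper integrals converge and lim_{R→∞} (1/(2π))·∫_{−R}^{R} e^{−i·k₀·x₀}/(−i·k₀ + λ) dk₀ = e^{−λ·x₀}. -/
open Filter

lemma hd_aux (lam x0 : ℝ) (hlam : 0 < lam) (k : ℝ) : -Complex.I * (k : ℂ) + (lam : ℂ) ≠ 0 := by
  intro h
  have := congrArg Complex.re h
  simp at this
  exact hlam.ne' this

lemma parts_aux (lam x0 : ℝ) (hlam : 0 < lam) (hx0 : 0 < x0) (R : ℝ) :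
    (∫ k0 : ℝ in (-R)..R, Complex.exp (-Complex.I * (k0 : ℂ) * (x0 : ℂ)) /
              (-Complex.I * (k0 : ℂ) + (lam : ℂ))) =
    (1 / x0 : ℂ) * (∫ k0 : ℝ in (-R)..R, Complex.exp (-Complex.I * (k0 : ℂ) * (x0 : ℂ)) /
              (-Complex.I * (k0 : ℂ) + (lam : ℂ)) ^ 2) +
    (Complex.I / x0) * (Complex.exp (-Complex.I * (R : ℂ) * (x0 : ℂ)) /
              (-Complex.I * (R : ℂ) + (lam : ℂ)) -
      Complex.exp (-Complex.I * ((-R : ℝ) : ℂ) * (x0 : ℂ)) /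
              (-Complex.I * ((-R : ℝ) : ℂ) + (lam : ℂ))) := by
  have hne := hd_aux lam x0 hlam
  have hx : (x0 : ℂ) ≠ 0 := by exact_mod_cast hx0.ne'
  have c1 : Continuous fun k0 : ℝ => Complex.exp (-Complex.I * (k0 : ℂ) * (x0 : ℂ)) /
              (-Complex.I * (k0 : ℂ) + (lam : ℂ)) :=
    Continuous.div (by fun_prop) (by fun_prop) hne
  have c2 : Continuous fun k0 : ℝ => Complex.exp (-Complex.I * (k0 : ℂ) * (x0 : ℂ)) /
              (-Complex.I * (k0 : ℂ) + (lam : ℂ)) ^ 2 :=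
    Continuous.div (by fun_prop) (by fun_prop) (fun k => pow_ne_zero 2 (hne k))
  have key := intervalIntegral.integral_eq_sub_of_hasDerivAt (a := -R) (b := R)
    (f := fun k0 : ℝ => Complex.exp (-Complex.I * (k0 : ℂ) * (x0 : ℂ)) /
              (-Complex.I * (k0 : ℂ) + (lam : ℂ)))
    (f' := fun k0 : ℝ => (-Complex.I * x0) * (Complex.exp (-Complex.I * (k0 : ℂ) * (x0 : ℂ)) /
              (-Complex.I * (k0 : ℂ) + (lam : ℂ))) +
        Complex.I * (Complex.exp (-Complex.I * (k0 : ℂ) * (x0 : ℂ)) /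
              (-Complex.I * (k0 : ℂ) + (lam : ℂ)) ^ 2)) ?_ ?_
  · rw [intervalIntegral.integral_add, intervalIntegral.integral_const_mul,
      intervalIntegral.integral_const_mul] at key
    · rw [← key]
      generalize (∫ k0 : ℝ in (-R)..R, Complex.exp (-Complex.I * (k0 : ℂ) * (x0 : ℂ)) /
              (-Complex.I * (k0 : ℂ) + (lam : ℂ))) = A
      generalize (∫ k0 : ℝ in (-R)..R, Complex.exp (-Complex.I * (k0 : ℂ) * (x0 : ℂ)) /
              (-Complex.I * (k0 : ℂ) + (lam : ℂ)) ^ 2) = B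
      field_simp
      linear_combination ((x0 : ℂ) * A - B) * Complex.I_sq
    · exact (continuous_const.mul c1).intervalIntegrable _ _
    · exact (continuous_const.mul c2).intervalIntegrable _ _
  · intro k _
    have h0 : HasDerivAt (fun k : ℝ => (k : ℂ)) 1 k := Complex.ofRealCLM.hasDerivAt
    have h1 := ((h0.const_mul (-Complex.I)).mul_const (x0 : ℂ)).cexp
    have h2 := (h0.const_mul (-Complex.I)).add_const (lam : ℂ)
    refine (h1.div h2 (hne k)).congr_deriv ?_
    have := hne k
    field_simp
    ring
  · exact ((continuous_const.mul c1).add (continuous_const.mul c2)).intervalIntegrable _ _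

lemma bdry_aux (lam x0 : ℝ) (hlam : 0 < lam) (l : Filter ℝ)
    (h : Tendsto (fun R : ℝ => |R|) l atTop) :
    Tendsto (fun R : ℝ => Complex.exp (-Complex.I * (R : ℂ) * (x0 : ℂ)) /
              (-Complex.I * (R : ℂ) + (lam : ℂ))) l (nhds 0) := by
  apply squeeze_zero_norm' (a := fun R => |R|⁻¹) _ (tendsto_inv_atTop_zero.comp h)
  filter_upwards [h.eventually_gt_atTop 0] with R hR
  rw [norm_div, Complex.norm_exp]
  have : |R| ≤ ‖-Complex.I * (R : ℂ) + (lam : ℂ)‖ := by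
    have := Complex.abs_im_le_norm (-Complex.I * (R : ℂ) + (lam : ℂ))
    simpa using this
  simp
  gcongr
  simpa using this

lemma int_aux (lam x0 : ℝ) (hlam : 0 < lam) : MeasureTheory.Integrable
    (fun k0 : ℝ => Complex.exp (-Complex.I * (k0 : ℂ) * (x0 : ℂ)) /
              (-Complex.I * (k0 : ℂ) + (lam : ℂ)) ^ 2) := by
  have hne := hd_aux lam x0 hlam
  have c2 : Continuous fun k0 : ℝ => Complex.exp (-Complex.I * (k0 : ℂ) * (x0 : ℂ)) /
              (-Complex.I * (k0 : ℂ) + (lam : ℂ)) ^ 2 :=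
    Continuous.div (by fun_prop) (by fun_prop) (fun k => pow_ne_zero 2 (hne k))
  have h := ((integrable_inv_one_add_sq.comp_mul_left' (inv_ne_zero hlam.ne')).const_mul
    ((lam^2)⁻¹))
  refine h.mono' c2.aestronglyMeasurable (Eventually.of_forall fun k => le_of_eq ?_)
  rw [norm_div, Complex.norm_exp, norm_pow, ← Complex.normSq_eq_norm_sq, Complex.normSq_apply]
  simp
  rw [← mul_inv]
  congr 1
  field_simp

lemma lap_aux (r : ℂ) (hr : 0 < r.re) :
    ∫ t : ℝ in Set.Ioi 0, (t : ℂ) * Complex.exp (-r * t) = 1 / r ^ 2 := by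
  have hr0 : r ≠ 0 := by rintro rfl; simp at hr
  have hint : MeasureTheory.IntegrableOn (fun t : ℝ => (t : ℂ) * Complex.exp (-r * t))
      (Set.Ioi 0) := by
    have := integrableOn_rpow_mul_exp_neg_mul_rpow (p := 1) (s := 1) (b := r.re)
      (by norm_num) (by norm_num) hr
    refine MeasureTheory.Integrable.mono' this (by
      exact Continuous.aestronglyMeasurable (by fun_prop)) ?_
    filter_upwards [MeasureTheory.ae_restrict_mem measurableSet_Ioi] with t ht
    have ht' : (0:ℝ) < t := ht
    simp [Complex.norm_exp, abs_of_pos ht']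
  have hlim : Tendsto (fun t : ℝ => -((t : ℂ) / r + 1 / r ^ 2) * Complex.exp (-r * t))
      atTop (nhds 0) := by
    have e0 : Tendsto (fun t : ℝ => Complex.exp (-r * t)) atTop (nhds 0) := by
      rw [tendsto_zero_iff_norm_tendsto_zero]
      have := tendsto_rpow_mul_exp_neg_mul_atTop_nhds_zero 0 r.re hr
      simpa [Complex.norm_exp] using this
    have e1 : Tendsto (fun t : ℝ => (t : ℂ) * Complex.exp (-r * t)) atTop (nhds 0) := by
      rw [tendsto_zero_iff_norm_tendsto_zero]
      have := tendsto_rpow_mul_exp_neg_mul_atTop_nhds_zero 1 r.re hr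
      refine this.congr' ?_
      filter_upwards [eventually_gt_atTop 0] with t ht
      simp [Complex.norm_exp, abs_of_pos ht]
    have := (e1.const_mul (-(1 / r))).add (e0.const_mul (-(1 / r ^ 2)))
    simp only [mul_zero, add_zero] at this
    refine this.congr fun t => by ring
  have := MeasureTheory.integral_Ioi_of_hasDerivAt_of_tendsto' (a := 0)
    (f := fun t : ℝ => -((t : ℂ) / r + 1 / r ^ 2) * Complex.exp (-r * t))
    (f' := fun t : ℝ => (t : ℂ) * Complex.exp (-r * t)) ?_ hint hlim
  · rw [this]; simp
  · intro t _
    have h0 : HasDerivAt (fun k : ℝ => (k : ℂ)) 1 t := Complex.ofRealCLM.hasDerivAt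
    refine ((((h0.div_const r).add_const (1 / r ^ 2)).neg).mul
      ((h0.const_mul (-r)).cexp)).congr_deriv ?_
    simp only [Pi.neg_apply]
    field_simp
    ring

noncomputable def gAux (lam : ℝ) : ℝ → ℂ := fun t => ((max t 0 * Real.exp (-lam * t) : ℝ) : ℂ)

open FourierTransform in
lemma four_aux (lam : ℝ) (hlam : 0 < lam) (w : ℝ) :
    𝓕 (gAux lam) w = 1 / (lam + 2 * Real.pi * w * Complex.I) ^ 2 := by
  rw [← lap_aux _ (by simpa using hlam), Real.fourier_real_eq_integral_exp_smul,
    ← MeasureTheory.integral_indicator measurableSet_Ioi]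
  congr 1
  ext t
  by_cases ht : 0 < t
  · rw [Set.indicator_of_mem (by exact ht)]
    simp only [gAux, max_eq_left ht.le, smul_eq_mul]
    push_cast
    rw [mul_left_comm, ← Complex.exp_add]
    congr 2
    ring
  · rw [Set.indicator_of_notMem (by exact ht)]
    simp [gAux, max_eq_right (not_lt.1 ht)]

open FourierTransform in
lemma inv_aux (lam x0 : ℝ) (hlam : 0 < lam) (hx0 : 0 < x0) :
    ∫ k0 : ℝ, Complex.exp (-Complex.I * (k0 : ℂ) * (x0 : ℂ)) /
              (-Complex.I * (k0 : ℂ) + (lam : ℂ)) ^ 2 =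
    2 * Real.pi * (x0 * Real.exp (-lam * x0) : ℝ) := by
  have hpi := Real.pi_pos
  have hc : Continuous (gAux lam) := by unfold gAux; fun_prop
  have hg : MeasureTheory.Integrable (gAux lam) := by
    have := integrableOn_rpow_mul_exp_neg_mul_rpow (p := 1) (s := 1) (b := lam)
      (by norm_num) (by norm_num) hlam
    rw [← MeasureTheory.integrable_indicator_iff measurableSet_Ioi] at this
    refine this.ofReal.congr (Eventually.of_forall fun t => ?_)
    by_cases ht : 0 < t
    · simp [gAux, max_eq_left ht.le, ht]
    · simp [gAux, max_eq_right (not_lt.1 ht), ht]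
  have hF : MeasureTheory.Integrable (𝓕 (gAux lam)) := by
    have := (int_aux lam 0 hlam).comp_mul_left' (R := -(2 * Real.pi)) (by simp [hpi.ne'])
    refine this.congr (Eventually.of_forall fun w => ?_)
    simp only [four_aux lam hlam]
    push_cast
    simp
    ring
  have h := congrFun (hc.fourierInv_fourier_eq hg hF) x0
  rw [Real.fourierInv_eq'] at h
  have hs := MeasureTheory.Measure.integral_comp_mul_left (fun k0 : ℝ => Complex.exp (-Complex.I * (k0 : ℂ) * (x0 : ℂ)) /
              (-Complex.I * (k0 : ℂ) + (lam : ℂ)) ^ 2) (-(2 * Real.pi))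
  have h2 : (∫ w : ℝ, (fun k0 : ℝ => Complex.exp (-Complex.I * (k0 : ℂ) * (x0 : ℂ)) /
              (-Complex.I * (k0 : ℂ) + (lam : ℂ)) ^ 2) (-(2 * Real.pi) * w)) = gAux lam x0 := by
    rw [← h]
    congr 1
    ext w
    rw [four_aux lam hlam, smul_eq_mul, mul_one_div]
    simp only [RCLike.inner_apply, conj_trivial]
    push_cast
    congr 2 <;> ring
  rw [h2] at hs
  have habs : |(-(2 * Real.pi))⁻¹| = (2 * Real.pi)⁻¹ := by
    rw [abs_inv, abs_neg, abs_of_pos (by positivity)]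
  rw [habs] at hs
  simp only [gAux, max_eq_left hx0.le] at hs
  rw [hs, Complex.real_smul]
  have : (Real.pi : ℂ) ≠ 0 := by exact_mod_cast hpi.ne'
  generalize (∫ k0 : ℝ, Complex.exp (-Complex.I * (k0 : ℂ) * (x0 : ℂ)) /
              (-Complex.I * (k0 : ℂ) + (lam : ℂ)) ^ 2) = B
  push_cast
  field_simp

/-- Zero-temperature frequency integral: for `λ > 0` and `x₀ > 0`, the symmetric
improper integrals converge and
`lim_{R→∞} (1/2π) ∫_{−R}^{R} e^{−ik₀x₀}/(−ik₀ + λ) dk₀ = e^{−λx₀}`. -/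
theorem stmt14 (lam x0 : ℝ) (hlam : 0 < lam) (hx0 : 0 < x0) :
    Tendsto
      (fun R : ℝ =>
        (1 / (2 * Real.pi) : ℂ) *
          ∫ k0 : ℝ in (-R)..R,
            Complex.exp (-Complex.I * (k0 : ℂ) * (x0 : ℂ)) /
              (-Complex.I * (k0 : ℂ) + (lam : ℂ)))
      atTop
      (nhds ((Real.exp (-lam * x0) : ℝ) : ℂ)) := by
  have hx : (x0 : ℂ) ≠ 0 := by exact_mod_cast hx0.ne'
  have hpi : (Real.pi : ℂ) ≠ 0 := by exact_mod_cast Real.pi_pos.ne'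
  have t1 := MeasureTheory.intervalIntegral_tendsto_integral (int_aux lam x0 hlam)
    tendsto_neg_atTop_atBot tendsto_id
  have t2 := bdry_aux lam x0 hlam atTop tendsto_abs_atTop_atTop
  have t3 := (bdry_aux lam x0 hlam atBot tendsto_abs_atBot_atTop).comp tendsto_neg_atTop_atBot
  have t := ((t1.const_mul (1 / x0 : ℂ)).add
    ((t2.sub t3).const_mul (Complex.I / x0))).const_mul (1 / (2 * Real.pi) : ℂ)
  rw [inv_aux lam x0 hlam hx0] at t
  convert t using 2
  · rw [parts_aux lam x0 hlam hx0]
    rfl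
  · push_cast
    field_simp
    ring
end

section
/- Let ε ≥ 0 and let (β_h)_{h ∈ ℤ, h ≤ 0} be a real sequence with |β_h| ≤ ε·2^{h/8} for all h ≤ 0. Then the sums ν_h := −Σ_{k=−∞}^{h} 2^{k−h−1}·β_k converge absolutely for every h ≤ 0, the sequence (ν_h)_{h ≤ 0} satisfies the flow equation ν_{h−1} = 2·ν_h + β_h for all h ≤ 0, it satisfies the bound |ν_h| ≤ ε·2^{h/8} for all h ≤ 0, and it is the unique solution of this recursion with ν_h → 0 as h → −∞. -/
open Filter

/-- The counterterm sequence `ν_h := −Σ_{k=−∞}^{h} 2^{k−h−1} β_k` (written below via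
`k = h − j`, `j ∈ ℕ`). -/
noncomputable def nuSeq (B : ℤ → ℝ) (h : ℤ) : ℝ :=
  -∑' j : ℕ, (2 : ℝ) ^ (-(j : ℝ) - 1) * B (h - j)

theorem nu_coef (j : ℕ) : (2 : ℝ) ^ (-(j : ℝ) - 1) = 1 / 2 * (1 / 2) ^ j := by
  rw [Real.rpow_sub (by norm_num), Real.rpow_neg (by norm_num), Real.rpow_natCast, Real.rpow_one]
  rw [one_div_pow]
  field_simp

theorem nu_term (ε : ℝ) (hε : 0 ≤ ε) (B : ℤ → ℝ)
    (hB : ∀ h : ℤ, h ≤ 0 → |B h| ≤ ε * (2 : ℝ) ^ ((h : ℝ) / 8)) (h : ℤ) (hh : h ≤ 0) (j : ℕ) :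
    |(2 : ℝ) ^ (-(j : ℝ) - 1) * B (h - j)| ≤
      (ε * (2 : ℝ) ^ ((h : ℝ) / 8)) / 2 * (1 / 2) ^ j := by
  have h1 := hB (h - j) (by omega)
  have h2 : (2 : ℝ) ^ (((h - j : ℤ) : ℝ) / 8) ≤ (2 : ℝ) ^ ((h : ℝ) / 8) := by
    apply Real.rpow_le_rpow_of_exponent_le (by norm_num)
    push_cast
    have : (0 : ℝ) ≤ j := Nat.cast_nonneg j
    linarith
  have h3 : |B (h - j)| ≤ ε * (2 : ℝ) ^ ((h : ℝ) / 8) :=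
    h1.trans (mul_le_mul_of_nonneg_left h2 hε)
  have h4 : (0 : ℝ) < 1 / 2 * (1 / 2) ^ j := by positivity
  rw [nu_coef, abs_mul, abs_of_pos h4]
  have := mul_le_mul_of_nonneg_left h3 h4.le
  linarith

theorem nu_hasSum (C : ℝ) : HasSum (fun j : ℕ => C / 2 * (1 / 2 : ℝ) ^ j) C := by
  have := hasSum_geometric_two.mul_left (C / 2)
  rwa [div_mul_cancel₀ C (by norm_num)] at this

/-- Flow-equation lemma for the counterterm: if `|β_h| ≤ ε 2^{h/8}` for all `h ≤ 0`,
then the sums `ν_h = −Σ_{k≤h} 2^{k−h−1} β_k` converge absolutely, satisfy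
`ν_{h−1} = 2ν_h + β_h` and `|ν_h| ≤ ε 2^{h/8}` for all `h ≤ 0`, and give the unique
solution of this recursion tending to `0` as `h → −∞`. -/
theorem stmt17 (ε : ℝ) (hε : 0 ≤ ε) (B : ℤ → ℝ)
    (hB : ∀ h : ℤ, h ≤ 0 → |B h| ≤ ε * (2 : ℝ) ^ ((h : ℝ) / 8)) :
    (∀ h : ℤ, h ≤ 0 → Summable (fun j : ℕ => |(2 : ℝ) ^ (-(j : ℝ) - 1) * B (h - j)|)) ∧
    (∀ h : ℤ, h ≤ 0 → nuSeq B (h - 1) = 2 * nuSeq B h + B h) ∧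
    (∀ h : ℤ, h ≤ 0 → |nuSeq B h| ≤ ε * (2 : ℝ) ^ ((h : ℝ) / 8)) ∧
    (∀ ν' : ℤ → ℝ, (∀ h : ℤ, h ≤ 0 → ν' (h - 1) = 2 * ν' h + B h) →
      Tendsto ν' atBot (nhds 0) → ∀ h : ℤ, h ≤ 0 → ν' h = nuSeq B h) := by
  have S : ∀ h : ℤ, h ≤ 0 →
      Summable (fun j : ℕ => |(2 : ℝ) ^ (-(j : ℝ) - 1) * B (h - j)|) := fun h hh =>
    Summable.of_nonneg_of_le (fun _ => abs_nonneg _) (nu_term ε hε B hB h hh)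
      (nu_hasSum _).summable
  have R : ∀ h : ℤ, h ≤ 0 → nuSeq B (h - 1) = 2 * nuSeq B h + B h := by
    intro h hh
    have e := (S h hh).of_abs.tsum_eq_zero_add
    have e2 : ∑' j : ℕ, (2 : ℝ) ^ (-((j + 1 : ℕ) : ℝ) - 1) * B (h - (j + 1 : ℕ)) =
        1 / 2 * ∑' j : ℕ, (2 : ℝ) ^ (-(j : ℝ) - 1) * B (h - 1 - j) := by
      rw [← tsum_mul_left]
      congr 1
      funext j
      rw [nu_coef, nu_coef, pow_succ]
      have : h - ((j + 1 : ℕ) : ℤ) = h - 1 - j := by push_cast; ring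
      rw [this]
      ring
    rw [e2, nu_coef] at e
    simp only [Nat.cast_zero, sub_zero, pow_zero] at e
    unfold nuSeq
    rw [e]
    ring
  have Bd : ∀ h : ℤ, h ≤ 0 → |nuSeq B h| ≤ ε * (2 : ℝ) ^ ((h : ℝ) / 8) := by
    intro h hh
    unfold nuSeq
    rw [abs_neg]
    rw [← Real.norm_eq_abs]
    refine tsum_of_norm_bounded (nu_hasSum _) fun j => ?_
    rw [Real.norm_eq_abs]
    exact nu_term ε hε B hB h hh j
  refine ⟨S, R, Bd, ?_⟩
  intro ν' hν ht h hh
  have D : ∀ n : ℕ, ν' (h - n) - nuSeq B (h - n) = 2 ^ n * (ν' h - nuSeq B h) := by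
    intro n
    induction n with
    | zero => simp
    | succ n ih =>
      have : h - ((n + 1 : ℕ) : ℤ) = h - n - 1 := by push_cast; ring
      rw [this, hν _ (by omega), R _ (by omega), pow_succ]
      linear_combination 2 * ih
  have hb : Tendsto (fun n : ℕ => h - (n : ℤ)) atTop atBot := by
    refine tendsto_atBot.2 fun b => ?_
    filter_upwards [eventually_ge_atTop (h - b).toNat] with n hn
    omega
  have t1 : Tendsto (fun n : ℕ => (1 / 2 : ℝ) ^ n * ε) atTop (nhds (0 * ε)) :=
    (tendsto_pow_atTop_nhds_zero_of_lt_one (by norm_num) (by norm_num)).mul_const ε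
  have t2 : Tendsto (fun n : ℕ => |ν' (h - n)| + (1 / 2 : ℝ) ^ n * ε) atTop (nhds (|0| + 0 * ε)) :=
    (ht.comp hb).abs.add t1
  have key : ∀ n : ℕ, |ν' h - nuSeq B h| ≤ |ν' (h - n)| + (1 / 2 : ℝ) ^ n * ε := by
    intro n
    have h1 : |nuSeq B (h - n)| ≤ ε := by
      refine (Bd _ (by omega)).trans (mul_le_of_le_one_right hε ?_)
      apply Real.rpow_le_one_of_one_le_of_nonpos (by norm_num)
      have : ((h - n : ℤ) : ℝ) ≤ 0 := by exact_mod_cast (by omega : h - (n : ℤ) ≤ 0)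
      linarith
    have h2 : ν' h - nuSeq B h = (1 / 2 : ℝ) ^ n * (ν' (h - n) - nuSeq B (h - n)) := by
      rw [D, ← mul_assoc, ← mul_pow]; norm_num
    have h3 : (0 : ℝ) ≤ (1 / 2 : ℝ) ^ n := by positivity
    have h4 : (1 / 2 : ℝ) ^ n ≤ 1 := pow_le_one₀ (by norm_num) (by norm_num)
    rw [h2, abs_mul, abs_of_nonneg h3]
    have h5 := abs_sub (ν' (h - n)) (nuSeq B (h - n))
    have h6 := mul_le_mul_of_nonneg_left h5 h3
    have h7 := mul_le_mul_of_nonneg_left h1 h3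
    have h8 := mul_le_mul_of_nonneg_right h4 (abs_nonneg (ν' (h - n)))
    linarith
  have := ge_of_tendsto' t2 key
  simp only [abs_zero, zero_mul, add_zero] at this
  exact sub_eq_zero.1 (abs_nonpos_iff.1 this)
end
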